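/- arXiv:1912.10382 — 4 statements merged into one kernel-verified Lean document; each statement's English description precedes it below -/
import Mathlib

section
/- Let F : ℝⁿ → ℝᵐ be continuous, let g : ℝⁿ → ℝᵐ be Lipschitz, let K ⊂ ℝⁿ be compact, and suppose g(ℝⁿ) ⊇ F(K). Then for every ε > 0 and every p ∈ [1,∞) there exists a continuous function φ : K → ℝⁿ such that (∫_K |F(x) − g(φ(x))|^p dx)^{1/p} ≤ ε. -/
open MeasureTheory Set

noncomputable section

/-- `φ` is the time-`τ` flow map of the ODE `ż = f(z)`, `z(0) = x`. -/
def IsFlowMap {E : Type*} [NormedAddCommGroup E] [NormedSpace ℝ E]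
    (f : E → E) (τ : ℝ) (φ : E → E) : Prop :=
  ∀ x : E, ∃ z : ℝ → E, z 0 = x ∧ (∀ t : ℝ, HasDerivAt z (f (z t)) t) ∧ φ x = z τ

/-- The attainable set `A_𝓕`: all finite compositions
`φ_{τ_k}^{f_k} ∘ ⋯ ∘ φ_{τ_1}^{f_1}` of flow maps of members of `𝓕` (`k ≥ 1`, `τ_i ≥ 0`). -/
def Attainable {E : Type*} [NormedAddCommGroup E] [NormedSpace ℝ E]
    (F : Set (E → E)) : Set (E → E) :=
  { φ | ∃ L : List ((E → E) × ℝ × (E → E)), L ≠ [] ∧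
      (∀ q ∈ L, q.1 ∈ F ∧ 0 ≤ q.2.1 ∧ IsFlowMap q.1 q.2.1 q.2.2) ∧
      φ = L.foldl (fun g q => q.2.2 ∘ g) id }

/-- The time-`T` attainable set `A_𝓕(T)`: compositions of flow maps with total
time horizon `T`. -/
def AttainableT {E : Type*} [NormedAddCommGroup E] [NormedSpace ℝ E]
    (F : Set (E → E)) (T : ℝ) : Set (E → E) :=
  { φ | ∃ L : List ((E → E) × ℝ × (E → E)), L ≠ [] ∧
      (∀ q ∈ L, q.1 ∈ F ∧ 0 ≤ q.2.1 ∧ IsFlowMap q.1 q.2.1 q.2.2) ∧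
      (L.map fun q => q.2.1).sum = T ∧
      φ = L.foldl (fun g q => q.2.2 ∘ g) id }

/-- Approximation closure: closure in the topology of compact convergence. -/
def ApproxClosure {α β : Type*} [TopologicalSpace α] [NormedAddCommGroup β]
    (A : Set (α → β)) : Set (α → β) :=
  { φ | ∀ K : Set α, IsCompact K → ∀ ε > 0, ∃ ψ ∈ A, ∀ x ∈ K, ‖φ x - ψ x‖ ≤ ε }

/-- A scalar well function on `ℝⁿ`: a Lipschitz function whose zero set is squeezed
between a nonempty bounded open convex set and its closure. -/
def IsWellFunctionScalar {n : ℕ} (h : (Fin n → ℝ) → ℝ) : Prop :=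
  (∃ L, LipschitzWith L h) ∧
  ∃ Ω : Set (Fin n → ℝ), Ω.Nonempty ∧ IsOpen Ω ∧ Convex ℝ Ω ∧ Bornology.IsBounded Ω ∧
    Ω ⊆ { x | h x = 0 } ∧ { x | h x = 0 } ⊆ closure Ω

/-- A (vector-valued) well function on `ℝⁿ`: each component is a scalar well function. -/
def IsWellFunction {n : ℕ} (h : (Fin n → ℝ) → (Fin n → ℝ)) : Prop :=
  ∀ i, IsWellFunctionScalar (fun x => h x i)

/-- A well function on `ℝ`: a Lipschitz function whose zero set is squeezed between a
nonempty bounded open interval and its closure. -/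
def IsWellFunction1 (h : ℝ → ℝ) : Prop :=
  (∃ L, LipschitzWith L h) ∧
  ∃ a b : ℝ, a < b ∧ Ioo a b ⊆ { x | h x = 0 } ∧ { x | h x = 0 } ⊆ Icc a b

/-- Restricted affine invariance: `𝓕` is closed under `f ↦ x ↦ D f(Ax + b)` where `D`, `A`
are diagonal, the entries of `D` are `±1` or `0`, and the entries of `A` are `≤ 1`. -/
def RestrictedAffineInvariant {n : ℕ} (F : Set ((Fin n → ℝ) → (Fin n → ℝ))) : Prop :=
  ∀ f ∈ F, ∀ D A : Fin n → ℝ, ∀ b : Fin n → ℝ,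
    (∀ i, D i = 1 ∨ D i = -1 ∨ D i = 0) → (∀ i, A i ≤ 1) →
    (fun x i => D i * f (fun j => A j * x j + b j) i) ∈ F

/-- If the image of `K` under a measurable map `F` is contained in the range of `g` and is
totally bounded, then `F` is uniformly approximated on `K` by `g ∘ ψ` for some simple function
`ψ`. -/
theorem exists_simpleFunc_dist_comp_le {α β γ : Type*} [MeasurableSpace α] [Nonempty α]
    [PseudoMetricSpace γ] [MeasurableSpace γ] [OpensMeasurableSpace γ] [Nonempty β]
    {F : α → γ} (hF : Measurable F) {g : β → γ} {K : Set α} (hK : TotallyBounded (F '' K))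
    (hcover : F '' K ⊆ range g) {η : ℝ} (hη : 0 < η) :
    ∃ ψ : SimpleFunc α β, ∀ x ∈ K, dist (F x) (g (ψ x)) ≤ η := by
  rcases K.eq_empty_or_nonempty with rfl | ⟨a, ha⟩
  · exact ⟨SimpleFunc.const α (Classical.arbitrary β), by simp⟩
  obtain ⟨t, htK, ht, htcover⟩ := Metric.finite_approx_of_totallyBounded hK η hη
  have htne : t.Nonempty := by
    obtain ⟨y, hy, -⟩ := mem_iUnion₂.1 (htcover (mem_image_of_mem F ha))
    exact ⟨y, hy⟩
  obtain ⟨e, rfl⟩ := ht.countable.exists_eq_range htne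
  choose z hz using fun k => hcover (htK (mem_range_self k))
  have hN : ∃ N, ∀ y ∈ range e, ∃ k ≤ N, e k = y := by
    choose! k hk using fun y (hy : y ∈ range e) => hy
    obtain ⟨N, hN⟩ := (ht.image k).bddAbove
    exact ⟨N, fun y hy => ⟨k y, hN (mem_image_of_mem k hy), hk y hy⟩⟩
  obtain ⟨N, hN⟩ := hN
  refine ⟨((SimpleFunc.nearestPtInd e N).map z).comp F hF, fun x hx => ?_⟩
  obtain ⟨y, hy, hxy⟩ := mem_iUnion₂.1 (htcover (mem_image_of_mem F hx))
  obtain ⟨k, hkN, rfl⟩ := hN y hy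
  have h := SimpleFunc.edist_nearestPt_le e (F x) hkN
  rw [SimpleFunc.nearestPt, SimpleFunc.map_apply, edist_dist, edist_dist,
    ENNReal.ofReal_le_ofReal_iff dist_nonneg] at h
  rw [SimpleFunc.coe_comp, Function.comp_apply, SimpleFunc.map_apply, hz, dist_comm]
  exact h.trans (dist_comm (F x) (e k) ▸ (Metric.mem_ball.1 hxy).le)

/-- **From approximation of functions to approximation of domain transformations.**
If `F : ℝⁿ → ℝᵐ` is continuous, `g : ℝⁿ → ℝᵐ` is Lipschitz, `K` is compact and
`g(ℝⁿ) ⊇ F(K)`, then for every `ε > 0` and `p ∈ [1, ∞)` there is a continuous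
`φ : K → ℝⁿ` with `‖F - g ∘ φ‖_{L^p(K)} ≤ ε`. -/
theorem composition_approximation
    {n m : ℕ}
    (F : (Fin n → ℝ) → (Fin m → ℝ)) (hF : Continuous F)
    (g : (Fin n → ℝ) → (Fin m → ℝ)) (hg : ∃ L, LipschitzWith L g)
    (K : Set (Fin n → ℝ)) (hK : IsCompact K)
    (hcover : F '' K ⊆ Set.range g) :
    ∀ ε > 0, ∀ p : ℝ, 1 ≤ p →
      ∃ φ : (Fin n → ℝ) → (Fin n → ℝ), ContinuousOn φ K ∧
        (∫ x in K, ‖F x - g (φ x)‖ ^ p) ^ (1 / p) ≤ ε := by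
  obtain ⟨L, hL⟩ := hg
  intro ε hε p hp
  have hp0 : 0 < p := one_pos.trans_le hp
  have hq0 : ENNReal.ofReal p ≠ 0 := (ENNReal.ofReal_pos.2 hp0).ne'
  have hq1 : 1 ≤ ENNReal.ofReal p := by simpa using ENNReal.ofReal_le_ofReal hp
  have : Fact (volume K < ⊤) := ⟨hK.measure_lt_top⟩
  set μ := volume.restrict K
  set c := (μ univ ^ (ENNReal.ofReal p).toReal⁻¹).toReal with hc
  have hc_top : μ univ ^ (ENNReal.ofReal p).toReal⁻¹ ≠ ⊤ :=
    ENNReal.rpow_ne_top_of_nonneg (by positivity) (measure_ne_top μ univ)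
  have hc0 : 0 ≤ c := ENNReal.toReal_nonneg
  obtain ⟨ψ, hψ⟩ := exists_simpleFunc_dist_comp_le hF.measurable
    (hK.image hF).totallyBounded hcover (η := ε / (2 * (c + 1))) (by positivity)
  obtain ⟨φ, hφ, -⟩ := (ψ.memLp_of_isFiniteMeasure (ENNReal.ofReal p)
    μ).exists_boundedContinuous_eLpNorm_sub_le ENNReal.ofReal_ne_top
    (ENNReal.ofReal_pos.2 (show 0 < ε / (2 * ((L : ℝ) + 1)) by positivity)).ne'
  refine ⟨φ, φ.continuous.continuousOn, ?_⟩
  have hgφ : Continuous fun x => F x - g (φ x) := hF.sub (hL.continuous.comp φ.continuous)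
  have hgψ : AEStronglyMeasurable (fun x => g (ψ x)) μ :=
    hL.continuous.comp_aestronglyMeasurable ψ.aestronglyMeasurable
  have hmem : MemLp (fun x => F x - g (φ x)) (ENNReal.ofReal p) μ := by
    obtain ⟨C, hC⟩ := hK.exists_bound_of_continuousOn hgφ.continuousOn
    exact MemLp.of_bound hgφ.aestronglyMeasurable C (ae_restrict_of_forall_mem hK.measurableSet hC)
  have hselect : eLpNorm (fun x => F x - g (ψ x)) (ENNReal.ofReal p) μ ≤
      ENNReal.ofReal (ε / 2) := by
    refine (eLpNorm_le_of_ae_bound (C := ε / (2 * (c + 1)))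
      (ae_restrict_of_forall_mem hK.measurableSet fun x hx => ?_)).trans ?_
    · simpa only [dist_eq_norm] using hψ x hx
    · rw [← ENNReal.ofReal_toReal hc_top, ← hc, ← ENNReal.ofReal_mul hc0]
      refine ENNReal.ofReal_le_ofReal ?_
      rw [mul_div_assoc', div_le_div_iff₀ (by positivity) two_pos]
      nlinarith
  have hsmooth : eLpNorm (fun x => g (ψ x) - g (φ x)) (ENNReal.ofReal p) μ ≤
      ENNReal.ofReal (ε / 2) := by
    refine (eLpNorm_le_mul_eLpNorm_of_ae_le_mul (c := L) (g := ⇑ψ - ⇑φ)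
      (.of_forall fun x => hL.norm_sub_le _ _) _).trans ((mul_le_mul_right hφ _).trans ?_)
    rw [← ENNReal.ofReal_mul L.coe_nonneg]
    refine ENNReal.ofReal_le_ofReal ?_
    rw [mul_div_assoc', div_le_div_iff₀ (by positivity) two_pos]
    nlinarith [L.coe_nonneg]
  have hsum : eLpNorm (fun x => F x - g (φ x)) (ENNReal.ofReal p) μ ≤ ENNReal.ofReal ε := by
    have h := eLpNorm_add_le (hF.aestronglyMeasurable.sub hgψ)
      (hgψ.sub (hL.continuous.comp φ.continuous).aestronglyMeasurable) hq1
    have heq : (fun x => F x - g (φ x)) =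
        (F - fun x => g (ψ x)) + ((fun x => g (ψ x)) - g ∘ φ) := by
      ext1 x
      simp
    rw [heq, ← add_halves ε, ENNReal.ofReal_add (half_pos hε).le (half_pos hε).le]
    exact h.trans (add_le_add hselect hsmooth)
  rw [hmem.eLpNorm_eq_integral_rpow_norm hq0 ENNReal.ofReal_ne_top,
    ENNReal.ofReal_le_ofReal_iff hε.le, ENNReal.toReal_ofReal hp0.le] at hsum
  rwa [one_div]
end
end

section
/- Let F : ℝⁿ → ℝᵐ be continuous, let g : ℝⁿ → ℝᵐ be Lipschitz, let K ⊂ ℝⁿ be compact, suppose g(ℝⁿ) ⊇ F(K), and let p ∈ [1,∞). Let Φ be a collection of continuous functions from ℝⁿ to ℝⁿ such that for every δ > 0 and every continuous φ₁ : ℝⁿ → ℝⁿ there exists φ₂ ∈ Φ with (∫_K |φ₁(x) − φ₂(x)|^p dx)^{1/p} ≤ δ. Then for every ε > 0 there exists φ ∈ Φ such that (∫_K |F(x) − g(φ(x))|^p dx)^{1/p} ≤ ε. -/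
open MeasureTheory Set

noncomputable section

/-- A continuous map whose values on a compact set lie in the range of a continuous map `g` is
uniformly approximated there by `g ∘ h` with `h` a simple function. -/
theorem exists_simpleFunc_norm_sub_comp_le
    {α β γ : Type*} [TopologicalSpace α] [MeasurableSpace α] [OpensMeasurableSpace α]
    [TopologicalSpace β] [TopologicalSpace.SeparableSpace β] [Nonempty β]
    [NormedAddCommGroup γ] [MeasurableSpace γ] [BorelSpace γ]
    {F : α → γ} (hF : Continuous F) {g : β → γ} (hg : Continuous g)
    {K : Set α} (hK : IsCompact K) (hcover : F '' K ⊆ range g) {ε : ℝ} (hε : 0 < ε) :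
    ∃ h : SimpleFunc α β, ∀ x ∈ K, ‖F x - g (h x)‖ ≤ ε := by
  set z : ℕ → β := TopologicalSpace.denseSeq β
  have hcov : F '' K ⊆ ⋃ k, Metric.ball (g (z k)) ε := by
    intro y hy
    obtain ⟨w, rfl⟩ := hcover hy
    obtain ⟨k, hk⟩ := (TopologicalSpace.denseRange_denseSeq β).exists_mem_open
      (Metric.isOpen_ball.preimage hg) ⟨w, Metric.mem_ball_self (x := g w) hε⟩
    exact mem_iUnion.2 ⟨k, Metric.mem_ball_comm.1 hk⟩
  obtain ⟨t, ht⟩ := (hK.image hF).elim_finite_subcover _ (fun _ => Metric.isOpen_ball) hcov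
  refine ⟨((SimpleFunc.nearestPtInd (g ∘ z) (t.sup id)).map z).comp F hF.measurable,
    fun x hx => ?_⟩
  obtain ⟨k, hkt, hk⟩ := mem_iUnion₂.1 (ht (mem_image_of_mem F hx))
  have hle := SimpleFunc.edist_nearestPt_le (g ∘ z) (F x) (Finset.le_sup (f := id) hkt)
  rw [edist_dist, edist_dist, ENNReal.ofReal_le_ofReal_iff dist_nonneg] at hle
  rw [← dist_eq_norm, dist_comm]
  rw [Metric.mem_ball, dist_comm] at hk
  exact hle.trans hk.le

/-- A continuous map is in `L^p` of any compact set. -/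
theorem Continuous.memLp_restrict_isCompact
    {α E : Type*} [TopologicalSpace α] [MeasurableSpace α] [OpensMeasurableSpace α]
    [TopologicalSpace.PseudoMetrizableSpace α]
    [NormedAddCommGroup E] [SecondCountableTopology E] {μ : Measure α}
    [IsFiniteMeasureOnCompacts μ] {f : α → E} (hf : Continuous f)
    {K : Set α} (hK : IsCompact K) (hKm : MeasurableSet K) (p : ENNReal) :
    MemLp f p (μ.restrict K) := by
  have : IsFiniteMeasure (μ.restrict K) := ⟨by simpa using hK.measure_lt_top⟩
  obtain ⟨C, hC⟩ := hK.exists_bound_of_continuousOn hf.continuousOn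
  exact MemLp.of_bound hf.aestronglyMeasurable C ((ae_restrict_iff' hKm).2 (.of_forall hC))

/-- For `f ∈ L^p`, the norm `(∫ ‖f‖ ^ p) ^ (1 / p)` is at most `c` iff `eLpNorm f p` is. -/
theorem MeasureTheory.MemLp.integral_rpow_norm_le_iff
    {α E : Type*} [MeasurableSpace α] [NormedAddCommGroup E] {μ : Measure α} {f : α → E}
    {p : ℝ} (hp : 1 ≤ p) (hf : MemLp f (ENNReal.ofReal p) μ) {c : ℝ} (hc : 0 ≤ c) :
    (∫ x, ‖f x‖ ^ p ∂μ) ^ (1 / p) ≤ c ↔ eLpNorm f (ENNReal.ofReal p) μ ≤ ENNReal.ofReal c := by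
  have hp0 : 0 < p := by linarith
  rw [hf.eLpNorm_eq_integral_rpow_norm (by simpa using hp0) ENNReal.ofReal_ne_top,
    ENNReal.toReal_ofReal hp0.le, ENNReal.ofReal_le_ofReal_iff hc, one_div]

/-- **Corollary: approximation through an `L^p`-dense transformation family.**
If `F` is continuous, `g` is Lipschitz with `g(ℝⁿ) ⊇ F(K)`, and `Φ` is a family of
continuous maps from `ℝⁿ` to `ℝⁿ` that can approximate any continuous map in `L^p(K)`,
then for every `ε > 0` some `φ ∈ Φ` satisfies `‖F - g ∘ φ‖_{L^p(K)} ≤ ε`. -/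
theorem composition_approximation_family
    {n m : ℕ}
    (F : (Fin n → ℝ) → (Fin m → ℝ)) (hF : Continuous F)
    (g : (Fin n → ℝ) → (Fin m → ℝ)) (hg : ∃ L, LipschitzWith L g)
    (K : Set (Fin n → ℝ)) (hK : IsCompact K)
    (hcover : F '' K ⊆ Set.range g)
    (p : ℝ) (hp : 1 ≤ p)
    (Φ : Set ((Fin n → ℝ) → (Fin n → ℝ)))
    (hΦcont : ∀ φ ∈ Φ, Continuous φ)
    (hΦdense : ∀ δ > 0, ∀ φ₁ : (Fin n → ℝ) → (Fin n → ℝ), Continuous φ₁ →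
      ∃ φ₂ ∈ Φ, (∫ x in K, ‖φ₁ x - φ₂ x‖ ^ p) ^ (1 / p) ≤ δ) :
    ∀ ε > 0, ∃ φ ∈ Φ, (∫ x in K, ‖F x - g (φ x)‖ ^ p) ^ (1 / p) ≤ ε := by
  obtain ⟨L, hL⟩ := hg
  intro ε hε
  have hKm := hK.measurableSet
  have : IsFiniteMeasure (volume.restrict K) := ⟨by simpa using hK.measure_lt_top⟩
  set μ : Measure (Fin n → ℝ) := volume.restrict K
  set q := ENNReal.ofReal p
  have hq : 1 ≤ q := by simpa [q] using hp
  set M : ℝ := (μ univ ^ q.toReal⁻¹).toReal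
  have hMfin : μ univ ^ q.toReal⁻¹ ≠ ⊤ :=
    ENNReal.rpow_ne_top_of_nonneg (by positivity) (measure_ne_top _ _)
  have hM : 0 ≤ M := ENNReal.toReal_nonneg
  set η : ℝ := ε / (M + 2 * L + 1)
  have hη : 0 < η := by positivity
  obtain ⟨h, hh⟩ := exists_simpleFunc_norm_sub_comp_le hF hL.continuous hK hcover hη
  obtain ⟨φ₁, -, hφ₁, hφ₁c, -⟩ :=
    (h.memLp_of_isFiniteMeasure q μ).exists_hasCompactSupport_eLpNorm_sub_le
      ENNReal.ofReal_ne_top (ε := ENNReal.ofReal η) (by simpa using hη)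
  obtain ⟨φ₂, hφ₂, hφ₁₂⟩ := hΦdense η hη φ₁ hφ₁c
  have hφ₂c := hΦcont φ₂ hφ₂
  refine ⟨φ₂, hφ₂, ?_⟩
  have hgφ := hL.continuous.comp hφ₂c
  have hgh : AEStronglyMeasurable (fun x => g (h x)) μ :=
    (h.map g).aestronglyMeasurable
  have hφ₁₂' : eLpNorm (φ₁ - φ₂) q μ ≤ ENNReal.ofReal η :=
    (((hφ₁c.sub hφ₂c).memLp_restrict_isCompact hK hKm q).integral_rpow_norm_le_iff hp hη.le).1
      hφ₁₂
  have hhφ : eLpNorm (⇑h - φ₂) q μ ≤ ENNReal.ofReal η + ENNReal.ofReal η := by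
    rw [← sub_add_sub_cancel _ φ₁]
    exact (eLpNorm_add_le (h.aestronglyMeasurable.sub hφ₁c.aestronglyMeasurable)
      (hφ₁c.sub hφ₂c).aestronglyMeasurable hq).trans (add_le_add hφ₁ hφ₁₂')
  refine (((hF.sub hgφ).memLp_restrict_isCompact hK hKm q).integral_rpow_norm_le_iff hp hε.le).2 ?_
  calc eLpNorm (fun x => F x - g (φ₂ x)) q μ
      = eLpNorm ((fun x => F x - g (h x)) + fun x => g (h x) - g (φ₂ x)) q μ := by
        congr 1; ext x; simp
    _ ≤ eLpNorm (fun x => F x - g (h x)) q μ + eLpNorm (fun x => g (h x) - g (φ₂ x)) q μ :=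
        eLpNorm_add_le (hF.aestronglyMeasurable.sub hgh)
          (hgh.sub hgφ.aestronglyMeasurable) hq
    _ ≤ ENNReal.ofReal M * ENNReal.ofReal η
          + ENNReal.ofReal L * (ENNReal.ofReal η + ENNReal.ofReal η) := by
        refine add_le_add ?_ ?_
        · rw [ENNReal.ofReal_toReal hMfin]
          exact eLpNorm_le_of_ae_bound ((ae_restrict_iff' hKm).2 (.of_forall hh))
        · refine (eLpNorm_le_mul_eLpNorm_of_ae_le_mul (.of_forall fun x => ?_) q).trans
            (mul_le_mul_right hhφ _)
          exact hL.norm_sub_le _ _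
    _ = ENNReal.ofReal ((M + 2 * L) * η) := by
        rw [← ENNReal.ofReal_add hη.le hη.le, ← ENNReal.ofReal_mul hM,
          ← ENNReal.ofReal_mul L.coe_nonneg, ← ENNReal.ofReal_add (by positivity) (by positivity)]
        ring_nf
    _ ≤ ENNReal.ofReal ε := by
        refine ENNReal.ofReal_le_ofReal ?_
        have hpos : 0 < M + 2 * L + 1 := by positivity
        calc (M + 2 * L) * η ≤ (M + 2 * L + 1) * η :=
            mul_le_mul_of_nonneg_right (by linarith) hη.le
          _ = ε := mul_div_cancel₀ _ hpos.ne'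
end
end

section
/- Let n = 1 and let 𝓕 be a family of Lipschitz functions from ℝ to ℝ with attainable set A_𝓕. Then every function in the approximation closure of A_𝓕 is monotone increasing (nondecreasing). -/
open MeasureTheory Set

noncomputable section

/-- Flow maps of a Lipschitz vector field on the line are increasing: trajectories cannot cross. -/
theorem IsFlowMap.monotone {f φ : ℝ → ℝ} {τ : ℝ} {L : NNReal} (hf : LipschitzWith L f)
    (hτ : 0 ≤ τ) (hφ : IsFlowMap f τ φ) : Monotone φ := by
  intro x y hxy
  obtain ⟨z, hz0, hz, hzτ⟩ := hφ x
  obtain ⟨w, hw0, hw, hwτ⟩ := hφ y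
  rw [hzτ, hwτ]
  by_contra! hlt
  have hcont : Continuous fun t => w t - z t :=
    (continuous_iff_continuousAt.2 fun t => (hw t).continuousAt).sub
      (continuous_iff_continuousAt.2 fun t => (hz t).continuousAt)
  obtain ⟨s, -, hs⟩ := intermediate_value_Icc' hτ hcont.continuousOn
    (show (0 : ℝ) ∈ Icc (w τ - z τ) (w 0 - z 0) from ⟨by linarith, by linarith⟩)
  have heq : w = z := ODE_solution_unique_univ (v := fun _ => f) (s := fun _ => univ)
    (fun _ => hf.lipschitzOnWith) (fun t => ⟨hw t, trivial⟩) (fun t => ⟨hz t, trivial⟩)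
    (sub_eq_zero.1 hs)
  exact absurd hlt (by simp [heq])

/-- Compositions of flow maps of Lipschitz vector fields on the line are increasing. -/
theorem Attainable.monotone {F : Set (ℝ → ℝ)} (hF : ∀ f ∈ F, ∃ L, LipschitzWith L f)
    {ψ : ℝ → ℝ} (hψ : ψ ∈ Attainable F) : Monotone ψ := by
  obtain ⟨l, -, hl, rfl⟩ := hψ
  refine List.foldlRecOn (motive := Monotone) l _ monotone_id fun g hg q hq => ?_
  obtain ⟨hqF, hτ, hflow⟩ := hl q hq
  obtain ⟨L, hL⟩ := hF _ hqF
  exact (hflow.monotone hL hτ).comp hg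

/-- Monotonicity passes to the approximation closure. -/
theorem ApproxClosure.monotone {A : Set (ℝ → ℝ)} (hA : ∀ ψ ∈ A, Monotone ψ)
    {φ : ℝ → ℝ} (hφ : φ ∈ ApproxClosure A) : Monotone φ := by
  intro x y hxy
  refine le_of_forall_pos_le_add fun ε hε => ?_
  obtain ⟨ψ, hψA, hψ⟩ := hφ {x, y} (toFinite _).isCompact (ε / 2) (half_pos hε)
  have hx := abs_le.1 (hψ x (by simp))
  have hy := abs_le.1 (hψ y (by simp))
  linarith [hA ψ hψA hxy]

/-- **In 1D, the closure of the attainable set contains only increasing functions.** -/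
theorem closure_attainable_monotone_1d
    (𝓕 : Set (ℝ → ℝ)) (h𝓕 : ∀ f ∈ 𝓕, ∃ L, LipschitzWith L f) :
    ∀ φ ∈ ApproxClosure (Attainable 𝓕), Monotone φ :=
  fun _ => ApproxClosure.monotone fun _ => Attainable.monotone h𝓕
end
end

section
/- Let φ : ℝ → ℝ be continuous and monotone increasing, and let 𝓕_ReLU = {x ↦ v·max(wx + b, 0) : v, w, b ∈ ℝ} be the one-dimensional ReLU control family. Then for every ε > 0 and every compact K ⊂ ℝ there exists ψ in the attainable set A_{𝓕_ReLU} such that sup_{x∈K} |φ(x) − ψ(x)| ≤ ε. -/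
open MeasureTheory Set

noncomputable section

/-- The one-dimensional ReLU control family `{x ↦ v·ReLU(wx + b)}`. -/
def ReLUFamily1 : Set (ℝ → ℝ) :=
  { f | ∃ v w b : ℝ, f = fun x => v * max (w * x + b) 0 }

/-- The time-one flow of a constant field in the ReLU family is a translation. -/
theorem isFlowMap_translation (c : ℝ) :
    IsFlowMap (fun x : ℝ => c * max (0 * x + 1) 0) 1 (fun x => x + c) := by
  intro x
  refine ⟨fun t => x + t * c, by simp, fun t => ?_, by simp⟩
  simpa using ((hasDerivAt_id t).mul_const c).const_add x

/-- The time-one flow of `v * ReLU (x - a)` fixes `(-∞, a]` and dilates `[a, ∞)` about `a`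
by the factor `exp v`. -/
theorem isFlowMap_kink (a v : ℝ) :
    IsFlowMap (fun x : ℝ => v * max (1 * x + -a) 0) 1
      (fun x => min x a + Real.exp v * max (x - a) 0) := by
  intro x
  refine ⟨fun t => min x a + Real.exp (t * v) * max (x - a) 0, ?_, fun t => ?_, by simp⟩
  · rcases le_total x a with h | h <;> simp [h]
  · have hd : HasDerivAt (fun t => min x a + Real.exp (t * v) * max (x - a) 0)
        (Real.exp (t * v) * (1 * v) * max (x - a) 0) t :=
      ((((hasDerivAt_id t).mul_const v).exp).mul_const _).const_add _
    refine hd.congr_deriv ?_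
    dsimp only
    rcases le_total x a with h | h
    · simp [h]
    · have hp : 0 ≤ Real.exp (t * v) * (x - a) :=
        mul_nonneg (Real.exp_pos _).le (sub_nonneg.2 h)
      have hs : 1 * (a + Real.exp (t * v) * (x - a)) + -a = Real.exp (t * v) * (x - a) := by ring
      rw [min_eq_right h, max_eq_left (sub_nonneg.2 h), hs, max_eq_left hp]
      ring

theorem strictMono_kink (a v : ℝ) :
    StrictMono (fun x : ℝ => min x a + Real.exp v * max (x - a) 0) := by
  intro x y hxy
  have he := Real.exp_pos v
  dsimp only
  rcases lt_or_ge x a with hx | hx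
  · rw [min_eq_left hx.le, max_eq_right (sub_nonpos.2 hx.le), mul_zero, add_zero]
    rcases le_total y a with hy | hy
    · rw [min_eq_left hy, max_eq_right (sub_nonpos.2 hy), mul_zero, add_zero]
      exact hxy
    · rw [min_eq_right hy, max_eq_left (sub_nonneg.2 hy)]
      have := mul_nonneg he.le (sub_nonneg.2 hy)
      linarith
  · have hy : a ≤ y := hx.trans hxy.le
    rw [min_eq_right hx, min_eq_right hy, max_eq_left (sub_nonneg.2 hx),
      max_eq_left (sub_nonneg.2 hy)]
    gcongr

/-- Attainable sets are closed under post-composition with a flow map of the family. -/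
theorem Attainable.flowMap_comp {E : Type*} [NormedAddCommGroup E] [NormedSpace ℝ E]
    {F : Set (E → E)} {f χ ψ : E → E} {τ : ℝ} (hψ : ψ ∈ Attainable F) (hf : f ∈ F)
    (hτ : 0 ≤ τ) (hχ : IsFlowMap f τ χ) : χ ∘ ψ ∈ Attainable F := by
  obtain ⟨L, -, hL, rfl⟩ := hψ
  refine ⟨L ++ [(f, τ, χ)], by simp, fun q hq => ?_, by simp⟩
  rcases List.mem_append.1 hq with hq | hq
  · exact hL q hq
  · obtain rfl := List.mem_singleton.1 hq
    exact ⟨hf, hτ, hχ⟩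

/-- ReLU flows interpolate finitely many points of any pair of strictly increasing sequences. -/
theorem exists_strictMono_attainable_interpolating {x y : ℕ → ℝ} (hx : StrictMono x)
    (hy : StrictMono y) (n : ℕ) :
    ∃ ψ ∈ Attainable ReLUFamily1, StrictMono ψ ∧ ∀ i ≤ n, ψ (x i) = y i := by
  induction n with
  | zero =>
    refine ⟨fun s => s + (y 0 - x 0),
      ⟨[(fun s => (y 0 - x 0) * max (0 * s + 1) 0, 1, fun s => s + (y 0 - x 0))],
        by simp, fun q hq => ?_, rfl⟩,
      fun s t h => by simpa using h, fun i hi => ?_⟩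
    · obtain rfl := List.mem_singleton.1 hq
      exact ⟨⟨y 0 - x 0, 0, 1, rfl⟩, zero_le_one, isFlowMap_translation _⟩
    · obtain rfl := Nat.le_zero.1 hi
      ring
  | succ n ih =>
    obtain ⟨ψ, hψ, hm, hi⟩ := ih
    have h₁ : 0 < ψ (x (n + 1)) - y n := by
      rw [← hi n le_rfl]
      exact sub_pos.2 (hm (hx n.lt_succ_self))
    have h₂ : 0 < y (n + 1) - y n := sub_pos.2 (hy n.lt_succ_self)
    set v := Real.log ((y (n + 1) - y n) / (ψ (x (n + 1)) - y n)) with hv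
    refine ⟨_, Attainable.flowMap_comp hψ ⟨v, 1, -y n, rfl⟩ zero_le_one (isFlowMap_kink (y n) v),
      (strictMono_kink (y n) v).comp hm, fun i hin => ?_⟩
    rcases Nat.le_succ_iff.1 hin with h | rfl
    · have := hy.monotone h
      simp [hi i h, this]
    · rw [Function.comp_apply, min_eq_right (sub_pos.1 h₁).le, max_eq_left h₁.le, hv,
        Real.exp_log (div_pos h₂ h₁), div_mul_cancel₀ _ h₁.ne']
      ring

theorem exists_attainable_approx_of_strictMono {φ : ℝ → ℝ} (hφc : Continuous φ)
    (hφm : StrictMono φ) {ε : ℝ} (hε : 0 < ε) {K : Set ℝ} (hK : IsCompact K) :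
    ∃ ψ ∈ Attainable ReLUFamily1, ∀ x ∈ K, |φ x - ψ x| ≤ ε := by
  obtain ⟨a, ha⟩ := hK.bddBelow
  obtain ⟨b, hb⟩ := hK.bddAbove
  obtain ⟨δ, hδ, hu⟩ := Metric.uniformContinuousOn_iff.1
    ((isCompact_Icc (a := a) (b := b + 1)).uniformContinuousOn_of_continuous hφc.continuousOn) ε hε
  obtain ⟨d, hd, hdm⟩ := exists_between (lt_min hδ one_pos)
  obtain ⟨hdδ, hd1⟩ := lt_min_iff.1 hdm
  have hgrid : StrictMono fun i : ℕ => a + i * d := fun i j hij => by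
    have : (i : ℝ) < j := Nat.cast_lt.2 hij
    dsimp only
    gcongr
  obtain ⟨ψ, hψ, hm, hi⟩ := exists_strictMono_attainable_interpolating hgrid (hφm.comp hgrid)
    (⌊(b - a) / d⌋₊ + 1)
  refine ⟨ψ, hψ, fun x hx => ?_⟩
  have hax : a ≤ x := ha hx
  have hxb : x ≤ b := hb hx
  have hle : ⌊(x - a) / d⌋₊ ≤ ⌊(b - a) / d⌋₊ := by gcongr
  have h₀ := hi _ (hle.trans (Nat.le_succ _))
  have h₁ := hi _ (Nat.succ_le_succ hle)
  have hl := (le_div_iff₀ hd).1 (Nat.floor_le (div_nonneg (sub_nonneg.2 hax) hd.le))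
  have hr := (div_lt_iff₀ hd).1 (Nat.lt_floor_add_one ((x - a) / d))
  generalize ⌊(x - a) / d⌋₊ = k at h₀ h₁ hl hr
  simp only [Function.comp_apply, Nat.succ_eq_add_one, Nat.cast_add, Nat.cast_one] at h₀ h₁
  have hkd : 0 ≤ (k : ℝ) * d := by positivity
  have hdist := hu (a + (k + 1) * d) ⟨by linarith, by linarith⟩ (a + k * d)
    ⟨by linarith, by linarith⟩ (by rw [Real.dist_eq, abs_of_nonneg] <;> linarith)
  rw [Real.dist_eq] at hdist
  have hgap := (abs_lt.1 hdist).2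
  have hx₀ : a + k * d ≤ x := by linarith
  have hx₁ : x ≤ a + (k + 1) * d := by linarith
  have hφ₀ := hφm.monotone hx₀
  have hφ₁ := hφm.monotone hx₁
  have hψ₀ := hm.monotone hx₀
  have hψ₁ := hm.monotone hx₁
  rw [abs_le]
  constructor <;> linarith

/-- **ReLU-driven flows approximate every continuous increasing function in 1D,
uniformly on compact sets.** -/
theorem relu_flow_universal_1d
    (φ : ℝ → ℝ) (hφc : Continuous φ) (hφm : Monotone φ) :
    ∀ ε > 0, ∀ K : Set ℝ, IsCompact K →
      ∃ ψ ∈ Attainable ReLUFamily1, ∀ x ∈ K, |φ x - ψ x| ≤ ε := by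
  intro ε hε K hK
  obtain ⟨ψ, hψ, h⟩ := exists_attainable_approx_of_strictMono
    (φ := fun x => φ x + ε / 4 * Real.arctan x)
    (hφc.add (continuous_const.mul Real.continuous_arctan))
    (hφm.add_strictMono (Real.arctan_strictMono.const_mul (by positivity)))
    (half_pos hε) hK
  refine ⟨ψ, hψ, fun x hx => ?_⟩
  have hx' := abs_le.1 (h x hx)
  have h₁ := Real.arctan_lt_pi_div_two x
  have h₂ := Real.neg_pi_div_two_lt_arctan x
  have hπ := Real.pi_lt_four
  rw [abs_le]
  constructor <;> nlinarith
end
end
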